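/- arXiv:2006.00485 — 4 statements merged into one kernel-verified Lean document; each statement's English description precedes it below -/
import Mathlib

section
/- Let n ≥ 1 and let f : ℝ × (Fin n → ℝ) × ℝ × (Fin n → ℝ) → ℝ, written f(E, x; β, X̃), be positive and continuously differentiable in (β, X̃) for each fixed (E, x). Suppose: (i) [consistency with thermodynamics] for every natural number N ≥ 1 and every assignment of values E : Fin N → ℝ and x : Fin N → (Fin n → ℝ), writing f_ω = f(E_ω, x_ω; β, X̃), Z(β,X̃) = ∑_{ω} f_ω and p_ω = f_ω / Z, there exists a twice continuously differentiable function B : ℝ × (Fin n → ℝ) → ℝ such that for all (β, X̃): ∑_ω p_ω E_ω = −∂B/∂β and, for each η : Fin n, ∑_ω p_ω x_ω(η) = ∂B/∂X̃_η; (ii) [positive specific heat] for every such N, E, x with E non-constant, the map β ↦ ∑_ω p_ω E_ω is strictly decreasing in β for each fixed X̃; (iii) [uniformity at infinite temperature] the value f(E, x; 0, 0) does not depend on (E, x). Then there exist a constant k < 0 and a function c : ℝ × (Fin n → ℝ) → ℝ such that f(E, x; β, X̃) = c(β, X̃) · exp(k·(β·E − ∑_{η} X̃_η · x(η))) for all E,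 x, β, X̃; in particular every ensemble of this form obeys the generalized Boltzmann distribution Pr(ω) ∝ exp(∑_η X̃_η x_ω(η) − β E_ω) up to a rescaling of β and X̃. -/
/-- If the gradient of `B` is `b + q • Δ` with `b` and `Δ` constant, then the coefficient `q`
only depends on the value of `Δ`. -/
theorem eq_of_fderiv_eq_add_smul {V : Type*} [NormedAddCommGroup V] [NormedSpace ℝ V]
    {B : V → ℝ} {b Δ : V →L[ℝ] ℝ} {q : V → ℝ}
    (hB : ∀ θ, HasFDerivAt B (b + q θ • Δ) θ) (hΔ : Δ ≠ 0) {θ θ' : V} (h : Δ θ = Δ θ') :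
    q θ = q θ' := by
  set g : V → ℝ := fun p => B p - b p with hg
  have hgd : ∀ p, HasFDerivAt g (q p • Δ) p := fun p =>
    ((hB p).sub b.hasFDerivAt).congr_fderiv (add_sub_cancel_left _ _)
  set v := θ' - θ with hv
  have hΔv : Δ v = 0 := by simp [hv, h]
  have htrans : (fun p => g (p + v)) = g := by
    funext p
    have hline : ∀ t : ℝ, HasDerivAt (fun t : ℝ => g (p + t • v)) 0 t := fun t => by
      have h1 : HasDerivAt (fun t : ℝ => p + t • v) v t := by
        simpa using ((hasDerivAt_id t).smul_const v).const_add p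
      have h2 : (q (p + t • v) • Δ) v = 0 := by simp [hΔv]
      have h3 := (hgd (p + t • v)).comp_hasDerivAt t h1
      rwa [h2] at h3
    simpa using is_const_of_deriv_eq_zero (fun t => (hline t).differentiableAt)
      (fun t => (hline t).deriv) 1 0
  have h1 : HasFDerivAt (fun p => g (p + v)) (q θ' • Δ) θ := by
    have h2 := hgd (θ + v)
    rw [show θ + v = θ' by simp [hv]] at h2
    exact (hasFDerivAt_comp_add_right v).2 (by simpa [hv] using h2)
  rw [htrans] at h1
  exact smul_left_injective ℝ hΔ ((hgd θ).unique h1)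

/-- The pairing `∑ η, x η * X η - E * β` of a microstate `(E, x)` with parameters `(β, X)`. -/
noncomputable def thermoPairing {n : ℕ} (a : ℝ × (Fin n → ℝ)) : ℝ × (Fin n → ℝ) →L[ℝ] ℝ :=
  ∑ η, a.2 η • (ContinuousLinearMap.proj (R := ℝ) (φ := fun _ : Fin n => ℝ) η ∘L
    ContinuousLinearMap.snd ℝ ℝ (Fin n → ℝ)) - a.1 • ContinuousLinearMap.fst ℝ ℝ (Fin n → ℝ)

theorem thermoPairing_apply {n : ℕ} (a θ : ℝ × (Fin n → ℝ)) :
    thermoPairing a θ = ∑ η, a.2 η * θ.2 η - a.1 * θ.1 := by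
  simp [thermoPairing]

theorem thermoPairing_sub_apply {n : ℕ} (a b θ : ℝ × (Fin n → ℝ)) :
    thermoPairing (a - b) θ = thermoPairing a θ - thermoPairing b θ := by
  simp only [thermoPairing_apply, Prod.fst_sub, Prod.snd_sub, Pi.sub_apply, sub_mul,
    Finset.sum_sub_distrib]
  ring

theorem thermoPairing_ne_zero {n : ℕ} {a : ℝ × (Fin n → ℝ)} (ha : a ≠ 0) :
    thermoPairing a ≠ 0 := by
  intro h
  apply ha
  ext η
  · simpa [thermoPairing_apply] using DFunLike.congr_fun h (1, 0)
  · simpa [thermoPairing_apply, Pi.single_apply] using DFunLike.congr_fun h (0, Pi.single η 1)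

/-- Partial derivatives given by `thermoPairing` coordinates determine the Fréchet derivative. -/
theorem fderiv_eq_of_partial_derivs {n : ℕ} {B : ℝ × (Fin n → ℝ) → ℝ}
    {θ a : ℝ × (Fin n → ℝ)} (hB : DifferentiableAt ℝ B θ)
    (h0 : a.1 = -deriv (fun b => B (b, θ.2)) θ.1)
    (h1 : ∀ η, a.2 η = deriv (fun t => B (θ.1, Function.update θ.2 η t)) (θ.2 η)) :
    HasFDerivAt B (thermoPairing a) θ := by
  have hβ : fderiv ℝ B θ (1, 0) = -a.1 := by
    rw [h0, neg_neg]
    refine (HasFDerivAt.comp_hasDerivAt (f := fun b => (b, θ.2)) θ.1 hB.hasFDerivAt ?_).deriv.symm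
    exact (hasDerivAt_id θ.1).prodMk (hasDerivAt_const _ _)
  have hX : ∀ η, fderiv ℝ B θ (0, Pi.single η 1) = a.2 η := fun η => by
    rw [h1]
    refine (HasFDerivAt.comp_hasDerivAt_of_eq
      (f := fun t => (θ.1, Function.update θ.2 η t)) (θ.2 η) hB.hasFDerivAt ?_
      (by simp)).deriv.symm
    exact (hasDerivAt_const _ _).prodMk (hasDerivAt_update θ.2 η (θ.2 η))
  refine hB.hasFDerivAt.congr_fderiv (ContinuousLinearMap.ext fun v => ?_)
  have hv : v = v.1 • (1, 0) + ∑ η, v.2 η • (0, Pi.single η 1) := by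
    ext
    · simp [Prod.fst_sum]
    · simp [Prod.snd_sum, Finset.sum_apply, Pi.single_apply]
  conv_lhs => rw [hv]
  simp only [map_add, map_sum, map_smul, hβ, hX, thermoPairing_apply, smul_eq_mul,
    mul_comm (v.2 _)]
  ring

/-- A continuous log-likelihood whose differences `r a - r b` depend on the parameters only through
`thermoPairing (a - b)` is proportional to `thermoPairing`. -/
theorem exists_forall_eq_mul_thermoPairing {n : ℕ} (hn : 1 ≤ n)
    {r : ℝ × (Fin n → ℝ) → ℝ × (Fin n → ℝ) → ℝ}
    (hcont : ∀ a, Continuous (r a)) (hzero : ∀ a, r a 0 = 0) (hr0 : ∀ θ, r 0 θ = 0)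
    (hr : ∀ a b θ θ', thermoPairing (a - b) θ = thermoPairing (a - b) θ' →
      r a θ - r b θ = r a θ' - r b θ') :
    ∃ l : ℝ, ∀ a θ, r a θ = l * thermoPairing a θ := by
  have hself : ∀ a θ θ', thermoPairing a θ = thermoPairing a θ' → r a θ = r a θ' := by
    intro a θ θ' h
    simpa [hr0] using hr a 0 θ θ' (by simpa using h)
  have hpair : ∀ a b θ, thermoPairing a θ = thermoPairing b θ → r a θ = r b θ := by
    intro a b θ h
    have := hr a b θ 0 (by simp [thermoPairing_sub_apply, h])
    simpa [hzero, sub_eq_zero] using this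
  have htransfer : ∀ a b θ θ' θ'', thermoPairing a θ = thermoPairing a θ'' →
      thermoPairing a θ'' = thermoPairing b θ'' → thermoPairing b θ'' = thermoPairing b θ' →
      r a θ = r b θ' := fun a b θ θ' θ'' h₁ h₂ h₃ =>
    (hself a θ θ'' h₁).trans ((hpair a b θ'' h₂).trans (hself b θ'' θ' h₃))
  set e : ℝ × (Fin n → ℝ) := (1, 0) with he
  set ψ : ℝ → ℝ := fun s => r e (-s, 0) with hψ
  have hx : ∀ (a : ℝ × (Fin n → ℝ)) (η : Fin n), a.2 η ≠ 0 → ∀ θ,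
      r a θ = ψ (thermoPairing a θ) := by
    intro a η hη θ
    set s := thermoPairing a θ with hs
    refine htransfer a e θ _ (-s, Pi.single η ((s - s * a.1) / a.2 η)) ?_ ?_ ?_
    · rw [← hs]
      simp [thermoPairing_apply, Pi.single_apply]
      field_simp
      ring
    · simp [thermoPairing_apply, Pi.single_apply, he]
      field_simp
      ring
    · simp [thermoPairing_apply, he]
  let i : Fin n := ⟨0, hn⟩
  set d : ℝ × (Fin n → ℝ) := (0, Pi.single i 1) with hd
  have hψ0 : ψ 0 = 0 := by
    have : ((-0 : ℝ), (0 : Fin n → ℝ)) = 0 := by simp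
    simp only [hψ, this, hzero]
  have hall : ∀ a θ, r a θ = ψ (thermoPairing a θ) := by
    intro a θ
    by_cases hη : ∃ η, a.2 η ≠ 0
    · obtain ⟨η, hη⟩ := hη
      exact hx a η hη θ
    push Not at hη
    by_cases hE : a.1 = 0
    · have : a = 0 := Prod.ext hE (funext hη)
      subst this
      rw [hr0, thermoPairing_apply]
      simp [hψ0]
    · set s := thermoPairing a θ with hs
      have hds : thermoPairing d (0, Pi.single i s) = s := by
        simp [thermoPairing_apply, hd, Pi.single_apply]
      have := htransfer a d θ (0, Pi.single i s) (-s / a.1, Pi.single i s) ?_ ?_ ?_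
      · rw [this, hx d i (by simp [hd]), hds]
      · rw [← hs]
        simp [thermoPairing_apply, hη]
        field_simp
      · simp [thermoPairing_apply, hη, hd, Pi.single_apply]
        field_simp
      · simp [thermoPairing_apply, hd, Pi.single_apply]
  have hsub : ∀ s t, ψ s - ψ t = ψ (s - t) := by
    intro s t
    have := hr e d (-s, Pi.single i t) (-(s - t), 0) (by
      simp [thermoPairing_apply, he, hd, Pi.single_apply]
      ring)
    simpa [hall, thermoPairing_apply, he, hd, Pi.single_apply, hψ0] using this
  let Ψ : ℝ →+ ℝ := AddMonoidHom.mk' ψ fun s t => by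
    have := hsub (s + t) t
    rw [add_sub_cancel_right] at this
    linarith
  have hΨ : Continuous Ψ := (hcont e).comp (by fun_prop)
  refine ⟨ψ 1, fun a θ => ?_⟩
  rw [hall]
  simpa [Ψ, mul_comm] using map_real_smul Ψ hΨ (thermoPairing a θ) 1


/-- **Theorem 1 of the paper (generalized Boltzmann distribution).**
If an ensemble's probability density is proportional to a positive, continuously
differentiable function `f` of the random variables `(E, x)` and the parameters
`(β, X̃)`, which is consistent with thermodynamics (existence of a potential `B`
with `U = -∂B/∂β` and `χ_η = ∂B/∂X̃_η` for every finite assignment of random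
variables), has positive specific heat (ensemble-average energy strictly
decreasing in `β` whenever `E` is non-constant), and is uniform at infinite
temperature (`β = 0`, `X̃ = 0`), then `f` has the generalized Boltzmann form
`f(E,x;β,X̃) = c(β,X̃) · exp(k·(β·E − ∑ η, X̃ η · x η))` for some constant `k < 0`. -/
theorem generalized_boltzmann_distribution
    (n : ℕ) (hn : 1 ≤ n)
    (f : ℝ → (Fin n → ℝ) → ℝ → (Fin n → ℝ) → ℝ)
    (hpos : ∀ (E : ℝ) (x : Fin n → ℝ) (β : ℝ) (X : Fin n → ℝ), 0 < f E x β X)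
    (hsmooth : ∀ (E : ℝ) (x : Fin n → ℝ),
      ContDiff ℝ 1 (fun p : ℝ × (Fin n → ℝ) => f E x p.1 p.2))
    -- (i) consistency with thermodynamics: existence of the potential B(β, X̃)
    (hconsist : ∀ (N : ℕ), 1 ≤ N → ∀ (E : Fin N → ℝ) (x : Fin N → Fin n → ℝ),
      ∃ B : ℝ × (Fin n → ℝ) → ℝ, ContDiff ℝ 2 B ∧
        ∀ (β : ℝ) (X : Fin n → ℝ),
          ((∑ ω, (f (E ω) (x ω) β X / ∑ ω', f (E ω') (x ω') β X) * E ω)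
              = - deriv (fun b => B (b, X)) β) ∧
          ∀ η : Fin n,
            (∑ ω, (f (E ω) (x ω) β X / ∑ ω', f (E ω') (x ω') β X) * x ω η)
              = deriv (fun t => B (β, Function.update X η t)) (X η))
    -- (ii) positive specific heat: ensemble-average energy strictly decreasing in β
    (hheat : ∀ (N : ℕ), 1 ≤ N → ∀ (E : Fin N → ℝ) (x : Fin N → Fin n → ℝ),
      (¬ ∀ ω ω' : Fin N, E ω = E ω') →
      ∀ X : Fin n → ℝ,
        StrictAnti (fun β : ℝ =>
          ∑ ω, (f (E ω) (x ω) β X / ∑ ω', f (E ω') (x ω') β X) * E ω))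
    -- (iii) uniformity at infinite temperature (β = 0, X̃ = 0)
    (hinf : ∀ (E : ℝ) (x : Fin n → ℝ) (E' : ℝ) (x' : Fin n → ℝ),
      f E x 0 0 = f E' x' 0 0) :
    ∃ k : ℝ, k < 0 ∧ ∃ c : ℝ → (Fin n → ℝ) → ℝ,
      ∀ (E : ℝ) (x : Fin n → ℝ) (β : ℝ) (X : Fin n → ℝ),
        f E x β X = c β X * Real.exp (k * (β * E - ∑ η, X η * x η)) := by
  set F : ℝ × (Fin n → ℝ) → ℝ × (Fin n → ℝ) → ℝ := fun a θ => f a.1 a.2 θ.1 θ.2 with hF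
  have hFpos : ∀ a θ, 0 < F a θ := fun a θ => hpos _ _ _ _
  have hratio : ∀ a b θ θ', thermoPairing (a - b) θ = thermoPairing (a - b) θ' →
      F a θ / F b θ = F a θ' / F b θ' := by
    intro a b θ θ' h
    rcases eq_or_ne a b with rfl | hab
    · rw [div_self (hFpos _ _).ne', div_self (hFpos _ _).ne']
    obtain ⟨B, hB, hB'⟩ := hconsist 2 one_le_two ![a.1, b.1] ![a.2, b.2]
    simp only [Fin.sum_univ_two, Matrix.cons_val_zero, Matrix.cons_val_one] at hB'
    have hq := eq_of_fderiv_eq_add_smul (B := B) (b := thermoPairing b)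
      (q := fun p => F a p / (F a p + F b p)) (fun p => ?_)
      (thermoPairing_ne_zero (sub_ne_zero.2 hab)) h
    · have h1 := hFpos a θ
      have h2 := hFpos b θ
      have h3 := hFpos a θ'
      have h4 := hFpos b θ'
      rw [div_eq_div_iff (by positivity) (by positivity)] at hq ⊢
      linarith
    · have hne : F a p + F b p ≠ 0 := (add_pos (hFpos a p) (hFpos b p)).ne'
      have hsum : F b p / (F a p + F b p) = 1 - F a p / (F a p + F b p) := by
        field_simp
        ring
      have hd := fderiv_eq_of_partial_derivs (B := B) (θ := p)
        (a := b + (F a p / (F a p + F b p)) • (a - b))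
        (hB.differentiable (by norm_num) p) ?_ fun η => ?_
      · refine hd.congr_fderiv (ContinuousLinearMap.ext fun v => ?_)
        simp only [thermoPairing_apply, add_apply, smul_apply, Prod.fst_add, Prod.snd_add,
          Prod.smul_fst, Prod.smul_snd, Pi.add_apply, Pi.smul_apply, smul_eq_mul, add_mul,
          mul_sub, Finset.sum_add_distrib, Finset.mul_sum, mul_assoc]
        ring
      · rw [← (hB' p.1 p.2).1]
        change _ = F a p / (F a p + F b p) * a.1 + F b p / (F a p + F b p) * b.1
        rw [hsum]
        simp
        ring
      · rw [← (hB' p.1 p.2).2 η]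
        change _ = F a p / (F a p + F b p) * a.2 η + F b p / (F a p + F b p) * b.2 η
        rw [hsum]
        simp
        ring
  obtain ⟨l, hl⟩ := exists_forall_eq_mul_thermoPairing hn
    (r := fun a θ => Real.log (F a θ / F 0 θ))
    (fun a => by
      have hc : ∀ a, Continuous (F a) := fun a => (hsmooth a.1 a.2).continuous
      exact ((hc a).div (hc 0) fun θ => (hFpos 0 θ).ne').log
        fun θ => (div_pos (hFpos a θ) (hFpos 0 θ)).ne')
    (fun a => by
      have : F a 0 = F 0 0 := hinf _ _ _ _
      rw [this, div_self (hFpos 0 0).ne', Real.log_one])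
    (fun θ => by rw [div_self (hFpos 0 θ).ne', Real.log_one])
    (fun a b θ θ' h => by
      have hlog : ∀ a b θ, Real.log (F a θ / F b θ) = Real.log (F a θ) - Real.log (F b θ) :=
        fun a b θ => Real.log_div (hFpos a θ).ne' (hFpos b θ).ne'
      have := congrArg Real.log (hratio a b θ θ' h)
      simp only [hlog] at this ⊢
      linarith)
  have hform : ∀ a θ, F a θ = F 0 θ * Real.exp (l * thermoPairing a θ) := by
    intro a θ
    rw [← hl, Real.exp_log (div_pos (hFpos a θ) (hFpos 0 θ)), mul_div_cancel₀ _ (hFpos 0 θ).ne']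
  have hlpos : 0 < l := by
    have hanti := hheat 2 one_le_two ![0, 1] ![0, 0] (fun h => by simpa using h 0 1) 0
      (zero_lt_one' ℝ)
    have h1 : ∀ β, f 1 0 β 0 = f 0 0 β 0 * Real.exp (-(l * β)) := fun β => by
      simpa [hF, thermoPairing_apply] using hform (1, 0) (β, 0)
    simp only [Fin.sum_univ_two, Matrix.cons_val_zero, Matrix.cons_val_one, mul_zero, zero_add,
      mul_one, h1] at hanti
    have h2 := hpos 0 0 0 0
    have h3 := hpos 0 0 1 0
    have h4 := Real.exp_pos (-l)
    simp only [neg_zero, Real.exp_zero, mul_one] at hanti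
    rw [div_lt_div_iff₀ (by positivity) (by positivity)] at hanti
    have h5 : Real.exp (-l) < 1 := by
      have h6 : 0 < f 0 0 0 0 * f 0 0 1 0 := mul_pos h2 h3
      by_contra hcon
      nlinarith
    linarith [Real.exp_lt_one_iff.1 h5]
  refine ⟨-l, neg_lt_zero.2 hlpos, fun β X => f 0 0 β X, fun E x β X => ?_⟩
  refine (hform (E, x) (β, X)).trans ?_
  simp only [thermoPairing_apply, hF, mul_comm (X _), Prod.fst_zero, Prod.snd_zero]
  congr 2
  ring
end

section
/- Let Ω be a nonempty finite set, γ : Ω → ℝ, and β ≠ 0 a real number. Define Z : ℝ → ℝ by Z(b) = ∑_{ω ∈ Ω} exp(b·γ(ω)) and, for each ω, p_ω(b) = exp(b·γ(ω)) / Z(b). Then the function b ↦ (log Z(b)) / b is differentiable at β and its derivative there equals (1/β²) · ∑_{ω ∈ Ω} p_ω(β) · log p_ω(β). Consequently, the entropy S = −k_B β² · d/dβ[(log Z)/β] of the generalized Boltzmann ensemble equals the Gibbs form S = −k_B ∑_ω Pr(ω) log Pr(ω). -/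
/-- **Theorem 2 of the paper (Gibbs entropy).**
For the generalized Boltzmann distribution `p ω (b) = exp (b·γ ω) / Z b` with
`Z b = ∑ ω, exp (b·γ ω)`, the free energy `(log Z)/b` is differentiable at any
`β ≠ 0`, with derivative `(1/β²) · ∑ ω, p ω (β) · log (p ω (β))`; hence the
entropy `S = −k_B β² d/dβ[(log Z)/β]` takes the Gibbs form
`S = −k_B ∑ ω Pr(ω) log Pr(ω)`. -/
theorem entropy_gibbs_form {Ω : Type*} [Fintype Ω] [Nonempty Ω]
    (γ : Ω → ℝ) (β : ℝ) (hβ : β ≠ 0) :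
    HasDerivAt (fun b : ℝ => Real.log (∑ ω, Real.exp (b * γ ω)) / b)
      ((1 / β ^ 2) *
        ∑ ω, (Real.exp (β * γ ω) / ∑ ω', Real.exp (β * γ ω')) *
          Real.log (Real.exp (β * γ ω) / ∑ ω', Real.exp (β * γ ω'))) β := by
  have hZ : 0 < ∑ ω, Real.exp (β * γ ω) :=
    Finset.sum_pos (fun ω _ => Real.exp_pos _) Finset.univ_nonempty
  have hderiv : HasDerivAt (fun b : ℝ => ∑ ω, Real.exp (b * γ ω))
      (∑ ω, Real.exp (β * γ ω) * γ ω) β :=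
    HasDerivAt.fun_sum fun ω _ => (hasDerivAt_mul_const (γ ω)).exp
  have hsum : ∑ ω, (Real.exp (β * γ ω) / ∑ ω', Real.exp (β * γ ω')) *
        Real.log (Real.exp (β * γ ω) / ∑ ω', Real.exp (β * γ ω')) =
      (∑ ω, Real.exp (β * γ ω) * γ ω) / (∑ ω, Real.exp (β * γ ω)) * β -
        Real.log (∑ ω, Real.exp (β * γ ω)) := by
    have hlog (ω : Ω) : Real.log (Real.exp (β * γ ω) / ∑ ω', Real.exp (β * γ ω')) =
        β * γ ω - Real.log (∑ ω', Real.exp (β * γ ω')) := by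
      rw [Real.log_div (Real.exp_ne_zero _) hZ.ne', Real.log_exp]
    simp_rw [hlog, mul_sub, Finset.sum_sub_distrib, ← Finset.sum_mul, ← Finset.sum_div]
    rw [div_self hZ.ne', one_mul, Finset.sum_div, Finset.sum_mul]
    congr 1
    exact Finset.sum_congr rfl fun ω _ => by ring
  rw [hsum]
  refine ((hderiv.log hZ.ne').fun_div (hasDerivAt_id' β) hβ).congr_deriv ?_
  ring
end

section
/- Let f : ℝ × ℝ × ℝ × ℝ → ℝ, written f(a,b,c,d), be differentiable at every point of the open set U = {(a,b,c,d) : 0 < a and 0 < c}. Suppose that at every point of U one has a·(∂f/∂b) + c·(∂f/∂d) = 0, where ∂f/∂b and ∂f/∂d denote the partial derivatives in the second and fourth coordinates. Then there exists a function g : ℝ × ℝ × ℝ → ℝ such that f(a,b,c,d) = g(a·d − b·c, a, c) for every (a,b,c,d) ∈ U. -/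
/-- A function satisfying `a·∂f/∂b + c·∂f/∂d = 0` has zero derivative along the characteristic
lines `t ↦ (a, a * t, c, d + c * t)`. -/
theorem hasDerivAt_characteristic (f : ℝ × ℝ × ℝ × ℝ → ℝ) (a c d t : ℝ)
    (hf : DifferentiableAt ℝ f (a, a * t, c, d + c * t))
    (hpde : a * deriv (fun s => f (a, s, c, d + c * t)) (a * t) +
      c * deriv (fun s => f (a, a * t, c, s)) (d + c * t) = 0) :
    HasDerivAt (fun s => f (a, a * s, c, d + c * s)) 0 t := by
  set L := fderiv ℝ f (a, a * t, c, d + c * t)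
  have hL : HasFDerivAt f L (a, a * t, c, d + c * t) := hf.hasFDerivAt
  have hb : HasDerivAt (fun s => f (a, s, c, d + c * t)) (L (0, 1, 0, 0)) (a * t) :=
    HasFDerivAt.comp_hasDerivAt (f := fun s : ℝ => (a, s, c, d + c * t)) (a * t) hL
      ((hasDerivAt_const _ a).prodMk ((hasDerivAt_id _).prodMk
        ((hasDerivAt_const _ c).prodMk (hasDerivAt_const _ (d + c * t)))))
  have hd : HasDerivAt (fun s => f (a, a * t, c, s)) (L (0, 0, 0, 1)) (d + c * t) :=
    HasFDerivAt.comp_hasDerivAt (f := fun s : ℝ => (a, a * t, c, s)) (d + c * t) hL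
      ((hasDerivAt_const _ a).prodMk ((hasDerivAt_const _ (a * t)).prodMk
        ((hasDerivAt_const _ c).prodMk (hasDerivAt_id _))))
  have hline : HasDerivAt (fun s => f (a, a * s, c, d + c * s)) (L (0, a, 0, c)) t :=
    HasFDerivAt.comp_hasDerivAt (f := fun s : ℝ => (a, a * s, c, d + c * s)) t hL
      ((hasDerivAt_const _ a).prodMk ((hasDerivAt_const_mul a).prodMk
        ((hasDerivAt_const _ c).prodMk ((hasDerivAt_const_mul c).const_add d))))
  rw [hb.deriv, hd.deriv] at hpde
  have hsplit : ((0, a, 0, c) : ℝ × ℝ × ℝ × ℝ) =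
      a • (0, 1, 0, 0) + c • (0, 0, 0, 1) := by simp
  rwa [hsplit, map_add, map_smul, map_smul, smul_eq_mul, smul_eq_mul, hpde] at hline

/-- **Lemma 1 of the paper.**
If `f(a,b,c,d)` is differentiable on the open set `{0 < a, 0 < c}` and satisfies
`a·∂f/∂b + c·∂f/∂d = 0` there, then `f` is a function of `(a·d − b·c, a, c)` alone. -/
theorem lemma_f_abcd (f : ℝ × ℝ × ℝ × ℝ → ℝ)
    (hdiff : ∀ p : ℝ × ℝ × ℝ × ℝ, 0 < p.1 → 0 < p.2.2.1 → DifferentiableAt ℝ f p)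
    (hpde : ∀ a b c d : ℝ, 0 < a → 0 < c →
      a * deriv (fun t => f (a, t, c, d)) b + c * deriv (fun t => f (a, b, c, t)) d = 0) :
    ∃ g : ℝ × ℝ × ℝ → ℝ, ∀ a b c d : ℝ, 0 < a → 0 < c →
      f (a, b, c, d) = g (a * d - b * c, a, c) := by
  refine ⟨fun q => f (q.2.1, 0, q.2.2, q.1 / q.2.1), fun a b c d ha hc => ?_⟩
  have hderiv (t : ℝ) := hasDerivAt_characteristic f a c ((a * d - b * c) / a) t
    (hdiff _ ha hc) (hpde _ _ _ _ ha hc)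
  have hconst := is_const_of_deriv_eq_zero (fun t => (hderiv t).differentiableAt)
    (fun t => (hderiv t).deriv) (b / a) 0
  have hb : a * (b / a) = b := by field_simp
  have hd : (a * d - b * c) / a + c * (b / a) = d := by field_simp; ring
  simpa [hb, hd] using hconst
end

section
/- Let f, g : ℝ × ℝ × ℝ → ℝ and C : ℝ × ℝ → ℝ be functions such that g(z,x,y) ≠ 0 for all (z,x,y). Suppose that for all real a, b and all (x,y) ≠ (0,0) one has f(a·x + b·y, x, y) = C(a,b) · g(a·x + b·y, x, y). Then C is constant: C(a,b) = C(a',b') for all (a,b), (a',b') ∈ ℝ². -/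
/-- **Lemma 2 of the paper.**
If `g` never vanishes and `f(a·x + b·y, x, y) = C(a,b) · g(a·x + b·y, x, y)` holds for
all `a, b` and all `(x,y) ≠ (0,0)`, then `C` is a constant function. -/
theorem lemma_C_constant (f g : ℝ × ℝ × ℝ → ℝ) (C : ℝ × ℝ → ℝ)
    (hg : ∀ z x y : ℝ, g (z, x, y) ≠ 0)
    (hfg : ∀ a b x y : ℝ, (x, y) ≠ ((0 : ℝ), (0 : ℝ)) →
      f (a * x + b * y, x, y) = C (a, b) * g (a * x + b * y, x, y)) :
    ∀ a b a' b' : ℝ, C (a, b) = C (a', b') := by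
  intro a b a' b'
  by_cases hxy : (b' - b, a - a') = ((0 : ℝ), (0 : ℝ))
  · obtain ⟨hb, ha⟩ := Prod.mk.inj hxy
    rw [sub_eq_zero.mp ha, sub_eq_zero.mp hb]
  · have h := hfg a b _ _ hxy
    have h' := hfg a' b' _ _ hxy
    have hz : a' * (b' - b) + b' * (a - a') = a * (b' - b) + b * (a - a') := by ring
    rw [hz] at h'
    exact mul_right_cancel₀ (hg _ _ _) (h.symm.trans h')
end
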